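/- arXiv:0912.5209 — 2 statements merged into one kernel-verified Lean document; each statement's English description precedes it below -/
import Mathlib

section
/- For every h-normal Γ-linear connection, the torsion T of the induced covariant derivative ∇ is given on the adapted frame by exactly eight nonzero families of components: T(δ/δt, δ/δt) = 0; T(δ/δx^j, δ/δt) = T^r_1j δ/δx^r + Rv^r_1j ∂/∂y^r with T^r_1j = −G^r_j and Rv^r_1j = (δ/δx^j)M^r − (δ/δt)N^r_j; T(δ/δx^j, δ/δx^i) = T^r_ij δ/δx^r + Rv^r_ij ∂/∂y^r with T^r_ij = L^r_ij − L^r_ji and Rv^r_ij = (δ/δx^j)N^r_i − (δ/δx^i)N^r_j; T(∂/∂y^j, δ/δt) = Pv^r_1j ∂/∂y^r with Pv^r_1j = ∂M^r/∂y^j − G^r_j + δ^r_j κ; T(∂/∂y^j, δ/δx^i) = C^r_ij δ/δx^r + Pv^r_ij ∂/∂y^r with Pv^r_ij = ∂N^r_i/∂y^j − L^r_ji; and T(∂/∂y^j, ∂/∂y^i) = (C^r_ij − C^r_ji) ∂/∂y^r. -/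
open Finset

noncomputable section

namespace Jet

/-- Smooth real-valued functions of `(t, x, y) ∈ ℝ × ℝⁿ × ℝⁿ`, the local coordinates
of the 1-jet space `J¹(ℝ, M)`. -/
abbrev Fn (n : ℕ) : Type := ℝ → (Fin n → ℝ) → (Fin n → ℝ) → ℝ

def Smooth {n : ℕ} (F : Fn n) : Prop :=
  ContDiff ℝ (⊤ : ℕ∞) (fun p : ℝ × (Fin n → ℝ) × (Fin n → ℝ) => F p.1 p.2.1 p.2.2)

/-- Partial derivative in the time variable `t`. -/
def pt {n : ℕ} (F : Fn n) : Fn n := fun t x y => deriv (fun s => F s x y) t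

/-- Partial derivative in the spatial variable `xⁱ`. -/
def px {n : ℕ} (i : Fin n) (F : Fn n) : Fn n :=
  fun t x y => deriv (fun s => F t (Function.update x i s) y) (x i)

/-- Partial derivative in the fibre variable `yⁱ`. -/
def py {n : ℕ} (i : Fin n) (F : Fn n) : Fn n :=
  fun t x y => deriv (fun s => F t x (Function.update y i s)) (y i)

/-- Kronecker delta, as a constant function on the jet space. -/
def kron {n : ℕ} (i j : Fin n) : Fn n := if i = j then 1 else 0

/-- The coordinate function `yⁱ`. -/
def yc {n : ℕ} (i : Fin n) : Fn n := fun _ _ y => y i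

/-- The Christoffel symbol `κ(t) = (1/(2h)) dh/dt` of a Riemannian metric `h` on `ℝ`,
as a function on the jet space. -/
def chr {n : ℕ} (h : ℝ → ℝ) : Fn n := fun t _ _ => deriv h t / (2 * h t)

/-- The metric `h(t)` as a function on the jet space. -/
def hfun {n : ℕ} (h : ℝ → ℝ) : Fn n := fun t _ _ => h t

/-- The derivative `dh/dt` as a function on the jet space. -/
def hder {n : ℕ} (h : ℝ → ℝ) : Fn n := fun t _ _ => deriv h t

variable {n : ℕ}

/-- The adapted temporal derivative `δ/δt = ∂/∂t − Mʳ ∂/∂yʳ` determined by a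
nonlinear connection `(M, N)`. -/
def dt (M : Fin n → Fn n) (F : Fn n) : Fn n := pt F - ∑ r, M r * py r F

/-- The adapted spatial derivative `δ/δxᵏ = ∂/∂xᵏ − Nʳₖ ∂/∂yʳ`. -/
def dx (N : Fin n → Fin n → Fn n) (k : Fin n) (F : Fn n) : Fn n :=
  px k F - ∑ r, N r k * py r F

/-- An `h`-normal `Γ`-linear connection `(κ, Gᵏᵢ, Lᵏᵢⱼ, Cᵏᵢⱼ)`. -/
structure Conn (n : ℕ) where
  κ : Fn n
  G : Fin n → Fin n → Fn n
  L : Fin n → Fin n → Fin n → Fn n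
  C : Fin n → Fin n → Fin n → Fn n

/-! ### Torsion d-tensors -/

/-- `Tʳ₁ⱼ = −Gʳⱼ`. -/
def T1 (Γ : Conn n) (r j : Fin n) : Fn n := -Γ.G r j

/-- `Rvʳ₁ⱼ = (δ/δxʲ)Mʳ − (δ/δt)Nʳⱼ`. -/
def Rv1 (M : Fin n → Fn n) (N : Fin n → Fin n → Fn n) (r j : Fin n) : Fn n :=
  dx N j (M r) - dt M (N r j)

/-- `Tʳᵢⱼ = Lʳᵢⱼ − Lʳⱼᵢ`. -/
def Tsp (Γ : Conn n) (r i j : Fin n) : Fn n := Γ.L r i j - Γ.L r j i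

/-- `Rvʳᵢⱼ = (δ/δxʲ)Nʳᵢ − (δ/δxⁱ)Nʳⱼ`. -/
def Rvsp (M : Fin n → Fn n) (N : Fin n → Fin n → Fn n) (r i j : Fin n) : Fn n :=
  dx N j (N r i) - dx N i (N r j)

/-- `Pvʳ₁ⱼ = ∂Mʳ/∂yʲ − Gʳⱼ + δʳⱼ κ`. -/
def Pv1 (M : Fin n → Fn n) (Γ : Conn n) (r j : Fin n) : Fn n :=
  py j (M r) - Γ.G r j + kron r j * Γ.κ

/-- `Phʳᵢⱼ = Cʳᵢⱼ`. -/
def Phsp (Γ : Conn n) (r i j : Fin n) : Fn n := Γ.C r i j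

/-- `Pvʳᵢⱼ = ∂Nʳᵢ/∂yʲ − Lʳⱼᵢ`. -/
def Pvsp (N : Fin n → Fin n → Fn n) (Γ : Conn n) (r i j : Fin n) : Fn n :=
  py j (N r i) - Γ.L r j i

/-- `Sʳᵢⱼ = Cʳᵢⱼ − Cʳⱼᵢ`. -/
def Ssp (Γ : Conn n) (r i j : Fin n) : Fn n := Γ.C r i j - Γ.C r j i

/-! ### Generic covariant derivatives of d-tensors -/

/-- Index types of the (valued) indices of a d-tensor: upper/lower spatial,
upper/lower vertical.  (Temporal indices carry no value; they are accounted for by the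
temporal weight `p` = number of upper temporal indices minus number of lower temporal
indices.) -/
inductive IdxType | uS | lS | uV | lV

/-- A d-tensor component family with `m` valued indices. -/
abbrev Tensor (n m : ℕ) := (Fin m → Fin n) → Fn n

/-- The `ℝ`-horizontal covariant derivative `D_{/1}` of a d-tensor `D` with valued index
signature `σ` and temporal weight `p`. -/
def covT {m : ℕ} (M : Fin n → Fn n) (Γ : Conn n) (p : ℤ) (σ : Fin m → IdxType)
    (D : Tensor n m) : Tensor n m := fun a =>
  dt M (D a) + p • (Γ.κ * D a)
    + ∑ q : Fin m,
      (match σ q with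
      | .uS => ∑ r, D (Function.update a q r) * Γ.G (a q) r
      | .lS => -∑ r, D (Function.update a q r) * Γ.G r (a q)
      | .uV => ∑ r, D (Function.update a q r) * (Γ.G (a q) r - kron (a q) r * Γ.κ)
      | .lV => -∑ r, D (Function.update a q r) * (Γ.G r (a q) - kron r (a q) * Γ.κ) : Fn n)

/-- The `M`-horizontal covariant derivative `D_{|k}`. -/
def covX {m : ℕ} (N : Fin n → Fin n → Fn n) (Γ : Conn n) (σ : Fin m → IdxType)
    (k : Fin n) (D : Tensor n m) : Tensor n m := fun a =>
  dx N k (D a)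
    + ∑ q : Fin m,
      (match σ q with
      | .uS => ∑ r, D (Function.update a q r) * Γ.L (a q) r k
      | .uV => ∑ r, D (Function.update a q r) * Γ.L (a q) r k
      | .lS => -∑ r, D (Function.update a q r) * Γ.L r (a q) k
      | .lV => -∑ r, D (Function.update a q r) * Γ.L r (a q) k : Fn n)

/-- The vertical covariant derivative `D|_{(k)}`. -/
def covY {m : ℕ} (Γ : Conn n) (σ : Fin m → IdxType)
    (k : Fin n) (D : Tensor n m) : Tensor n m := fun a =>
  py k (D a)
    + ∑ q : Fin m,
      (match σ q with
      | .uS => ∑ r, D (Function.update a q r) * Γ.C (a q) r k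
      | .uV => ∑ r, D (Function.update a q r) * Γ.C (a q) r k
      | .lS => -∑ r, D (Function.update a q r) * Γ.C r (a q) k
      | .lV => -∑ r, D (Function.update a q r) * Γ.C r (a q) k : Fn n)

/-- The coefficients `Cᵏᵢⱼ` viewed as a d-tensor with signature
(upper spatial, lower spatial, lower vertical). -/
def CT (Γ : Conn n) : Tensor n 3 := fun a => Γ.C (a 0) (a 1) (a 2)

/-- The signature of `Cᵏᵢⱼ`. -/
def sigC : Fin 3 → IdxType := ![IdxType.uS, IdxType.lS, IdxType.lV]

/-! ### Curvature d-tensors -/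

/-- `Rˡᵢ₁ₖ`. -/
def Rc1 (M : Fin n → Fn n) (N : Fin n → Fin n → Fn n) (Γ : Conn n) (l i k : Fin n) : Fn n :=
  dx N k (Γ.G l i) - dt M (Γ.L l i k) + ∑ r, Γ.G r i * Γ.L l r k
    - ∑ r, Γ.L r i k * Γ.G l r + ∑ r, Γ.C l i r * Rv1 M N r k

/-- `Rˡᵢⱼₖ`. -/
def Rc (M : Fin n → Fn n) (N : Fin n → Fin n → Fn n) (Γ : Conn n) (l i j k : Fin n) : Fn n :=
  dx N k (Γ.L l i j) - dx N j (Γ.L l i k) + ∑ r, Γ.L r i j * Γ.L l r k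
    - ∑ r, Γ.L r i k * Γ.L l r j + ∑ r, Γ.C l i r * Rvsp M N r j k

/-- `Pˡᵢ₁₍ₖ₎`. -/
def Pc1 (M : Fin n → Fn n) (N : Fin n → Fin n → Fn n) (Γ : Conn n) (l i k : Fin n) : Fn n :=
  py k (Γ.G l i) - covT M Γ 0 sigC (CT Γ) ![l, i, k] + ∑ r, Γ.C l i r * Pv1 M Γ r k

/-- `Pˡᵢⱼ₍ₖ₎`. -/
def Pc (M : Fin n → Fn n) (N : Fin n → Fin n → Fn n) (Γ : Conn n) (l i j k : Fin n) : Fn n :=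
  py k (Γ.L l i j) - covX N Γ sigC j (CT Γ) ![l, i, k] + ∑ r, Γ.C l i r * Pvsp N Γ r j k

/-- `Sˡᵢ₍ⱼ₎₍ₖ₎`. -/
def Sc (Γ : Conn n) (l i j k : Fin n) : Fn n :=
  py k (Γ.C l i j) - py j (Γ.C l i k)
    + ∑ r, Γ.C r i j * Γ.C l r k - ∑ r, Γ.C r i k * Γ.C l r j

end Jet

namespace Jet

variable {n : ℕ}

/-- A vector field on the jet space, given by its coordinate components
`V = Vᵗ ∂/∂t + Vˣⁱ ∂/∂xⁱ + Vʸⁱ ∂/∂yⁱ`. -/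
structure VF (n : ℕ) where
  t : Fn n
  x : Fin n → Fn n
  y : Fin n → Fn n

/-- The action `X(f)` of a vector field on a scalar function. -/
def Xact (X : VF n) (f : Fn n) : Fn n :=
  X.t * pt f + ∑ i, X.x i * px i f + ∑ i, X.y i * py i f

/-- The Lie bracket `[X, Y]` of vector fields, in coordinates. -/
def bracket (X Y : VF n) : VF n :=
  ⟨Xact X Y.t - Xact Y X.t, fun i => Xact X (Y.x i) - Xact Y (X.x i),
    fun i => Xact X (Y.y i) - Xact Y (X.y i)⟩

/-- The adapted vertical component of a vector field:
`V = Vᵗ δ/δt + Vˣⁱ δ/δxⁱ + (aV V)ⁱ ∂/∂yⁱ`. -/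
def aV (M : Fin n → Fn n) (N : Fin n → Fin n → Fn n) (V : VF n) (i : Fin n) : Fn n :=
  V.y i + V.t * M i + ∑ j, V.x j * N i j

/-- The vector field `cT δ/δt + Σᵢ cH i · δ/δxⁱ + Σᵢ cV i · ∂/∂yⁱ`, in coordinates. -/
def comb (M : Fin n → Fn n) (N : Fin n → Fin n → Fn n)
    (cT : Fn n) (cH cV : Fin n → Fn n) : VF n :=
  ⟨cT, cH, fun k => cV k - cT * M k - ∑ r, cH r * N k r⟩

/-- The adapted frame field `δ/δt`. -/
def delt (M : Fin n → Fn n) (N : Fin n → Fin n → Fn n) : VF n := comb M N 1 0 0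

/-- The adapted frame field `δ/δxⁱ`. -/
def delx (M : Fin n → Fn n) (N : Fin n → Fin n → Fn n) (i : Fin n) : VF n :=
  comb M N 0 (fun j => kron j i) 0

/-- The adapted frame field `∂/∂yⁱ`. -/
def party (M : Fin n → Fn n) (N : Fin n → Fin n → Fn n) (i : Fin n) : VF n :=
  comb M N 0 0 (fun r => kron r i)

/-- The covariant derivative `∇_X Z` induced by an `h`-normal `Γ`-linear connection:
it is defined on the adapted frame by
`∇_{δ/δt}(δ/δt) = κ δ/δt`, `∇_{δ/δt}(δ/δxⁱ) = Gᵏᵢ δ/δxᵏ`,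
`∇_{δ/δt}(∂/∂yⁱ) = (Gᵏᵢ − δᵏᵢ κ) ∂/∂yᵏ`, `∇_{δ/δxʲ}(δ/δt) = 0`,
`∇_{δ/δxʲ}(δ/δxⁱ) = Lᵏᵢⱼ δ/δxᵏ`, `∇_{δ/δxʲ}(∂/∂yⁱ) = Lᵏᵢⱼ ∂/∂yᵏ`,
`∇_{∂/∂yʲ}(δ/δt) = 0`, `∇_{∂/∂yʲ}(δ/δxⁱ) = Cᵏᵢⱼ δ/δxᵏ`,
`∇_{∂/∂yʲ}(∂/∂yⁱ) = Cᵏᵢⱼ ∂/∂yᵏ`, and extended by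
`∇_{fX+gY} Z = f ∇_X Z + g ∇_Y Z`, `∇_X (fZ) = X(f) Z + f ∇_X Z`. -/
def nabla (M : Fin n → Fn n) (N : Fin n → Fin n → Fn n) (Γ : Conn n)
    (X Z : VF n) : VF n :=
  let Tc : Fn n := Xact X Z.t + Z.t * X.t * Γ.κ
  let Hc : Fin n → Fn n := fun k =>
    Xact X (Z.x k) + ∑ i, Z.x i *
      (X.t * Γ.G k i + ∑ j, X.x j * Γ.L k i j + ∑ j, aV M N X j * Γ.C k i j)
  let Vc : Fin n → Fn n := fun k =>
    Xact X (aV M N Z k) + ∑ i, aV M N Z i *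
      (X.t * (Γ.G k i - kron k i * Γ.κ) + ∑ j, X.x j * Γ.L k i j
        + ∑ j, aV M N X j * Γ.C k i j)
  ⟨Tc, Hc, fun k => Vc k - Tc * M k - ∑ i, Hc i * N k i⟩

/-- The torsion `T(X,Y) = ∇_X Y − ∇_Y X − [X,Y]`. -/
def Tor (M : Fin n → Fn n) (N : Fin n → Fin n → Fn n) (Γ : Conn n) (X Y : VF n) : VF n :=
  let A := nabla M N Γ X Y
  let B := nabla M N Γ Y X
  let Br := bracket X Y
  ⟨A.t - B.t - Br.t, fun i => A.x i - B.x i - Br.x i, fun i => A.y i - B.y i - Br.y i⟩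

/-- The curvature `R(X,Y)Z = ∇_X ∇_Y Z − ∇_Y ∇_X Z − ∇_{[X,Y]} Z`. -/
def Rcurv (M : Fin n → Fn n) (N : Fin n → Fin n → Fn n) (Γ : Conn n) (X Y Z : VF n) : VF n :=
  let A := nabla M N Γ X (nabla M N Γ Y Z)
  let B := nabla M N Γ Y (nabla M N Γ X Z)
  let Cc := nabla M N Γ (bracket X Y) Z
  ⟨A.t - B.t - Cc.t, fun i => A.x i - B.x i - Cc.x i, fun i => A.y i - B.y i - Cc.y i⟩

/-- The zero vector field. -/
def VF.zero : VF n := ⟨0, 0, 0⟩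

/-- `X` is one of the adapted frame fields. -/
def IsAdapted (M : Fin n → Fn n) (N : Fin n → Fin n → Fn n) (X : VF n) : Prop :=
  X = delt M N ∨ (∃ i, X = delx M N i) ∨ (∃ i, X = party M N i)

end Jet

namespace Jet

section AdaptedFrame

variable {n : ℕ} (M : Fin n → Fn n) (N : Fin n → Fin n → Fn n) (Γ : Conn n)

/-! ### Partial derivatives of constants and of negated functions -/

lemma pt_neg (F : Fn n) : pt (-F) = -pt F := by
  funext t x y
  exact deriv.fun_neg

lemma px_neg (i : Fin n) (F : Fn n) : px i (-F) = -px i F := by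
  funext t x y
  exact deriv.fun_neg

lemma py_neg (i : Fin n) (F : Fn n) : py i (-F) = -py i F := by
  funext t x y
  exact deriv.fun_neg

lemma Xact_neg (X : VF n) (F : Fn n) : Xact X (-F) = -Xact X F := by
  simp only [Xact, pt_neg, px_neg, py_neg, mul_neg, sum_neg_distrib]
  ring

lemma Xact_const (X : VF n) (c : ℝ) : Xact X (fun _ _ _ => c) = 0 := by
  have ht : pt (fun _ _ _ => c : Fn n) = 0 := by
    funext t x y
    exact deriv_const t c
  have hx (i : Fin n) : px i (fun _ _ _ => c) = 0 := by
    funext t x y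
    exact deriv_const (x i) c
  have hy (i : Fin n) : py i (fun _ _ _ => c) = 0 := by
    funext t x y
    exact deriv_const (y i) c
  simp [Xact, ht, hx, hy]

lemma Xact_zero (X : VF n) : Xact X 0 = 0 := Xact_const X 0

lemma Xact_one (X : VF n) : Xact X 1 = 0 := Xact_const X 1

lemma Xact_kron (X : VF n) (i j : Fin n) : Xact X (kron i j) = 0 := by
  unfold kron
  split_ifs
  · exact Xact_one X
  · exact Xact_zero X

lemma sum_kron_mul (i : Fin n) (F : Fin n → Fn n) : ∑ k, kron k i * F k = F i := by
  simp [kron]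

/-! ### The adapted frame -/

lemma delt_t : (delt M N).t = 1 := rfl

lemma delt_x (i : Fin n) : (delt M N).x i = 0 := rfl

lemma delt_y (i : Fin n) : (delt M N).y i = -M i := by
  simp [delt, comb]

lemma delx_t (j : Fin n) : (delx M N j).t = 0 := rfl

lemma delx_x (j i : Fin n) : (delx M N j).x i = kron i j := rfl

lemma delx_y (j i : Fin n) : (delx M N j).y i = -N i j := by
  simp [delx, comb, sum_kron_mul]

lemma party_t (j : Fin n) : (party M N j).t = 0 := rfl

lemma party_x (j i : Fin n) : (party M N j).x i = 0 := rfl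

lemma party_y (j i : Fin n) : (party M N j).y i = kron i j := by
  simp [party, comb]

lemma aV_comb (cT : Fn n) (cH cV : Fin n → Fn n) (i : Fin n) :
    aV M N (comb M N cT cH cV) i = cV i := by
  simp only [aV, comb]
  ring

lemma aV_delt (i : Fin n) : aV M N (delt M N) i = 0 := aV_comb M N _ _ _ i

lemma aV_delx (j i : Fin n) : aV M N (delx M N j) i = 0 := aV_comb M N _ _ _ i

lemma aV_party (j i : Fin n) : aV M N (party M N j) i = kron i j := aV_comb M N _ _ _ i

lemma Xact_delt (F : Fn n) : Xact (delt M N) F = dt M F := by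
  simp [Xact, dt, delt_t, delt_x, delt_y, sub_eq_add_neg]

lemma Xact_delx (j : Fin n) (F : Fn n) : Xact (delx M N j) F = dx N j F := by
  simp [Xact, dx, delx_t, delx_x, delx_y, sum_kron_mul, sub_eq_add_neg]

lemma Xact_party (j : Fin n) (F : Fn n) : Xact (party M N j) F = py j F := by
  simp [Xact, party_t, party_x, party_y, sum_kron_mul]

/-! ### The covariant derivative on the adapted frame -/

lemma nabla_delt_delt : nabla M N Γ (delt M N) (delt M N) = comb M N Γ.κ 0 0 := by
  simp [nabla, comb, delt_t, delt_x, aV_delt, Xact_zero, Xact_one, ← Pi.zero_def]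

lemma nabla_delt_delx (i : Fin n) :
    nabla M N Γ (delt M N) (delx M N i) = comb M N 0 (fun k => Γ.G k i) 0 := by
  simp [nabla, comb, delt_t, delt_x, aV_delt, delx_t, delx_x, aV_delx, Xact_zero, Xact_kron,
    sum_kron_mul, ← Pi.zero_def]

lemma nabla_delt_party (i : Fin n) :
    nabla M N Γ (delt M N) (party M N i) =
      comb M N 0 0 (fun k => Γ.G k i - kron k i * Γ.κ) := by
  simp [nabla, comb, delt_t, delt_x, aV_delt, party_t, party_x, aV_party, Xact_zero, Xact_kron,
    sum_kron_mul, ← Pi.zero_def]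

lemma nabla_delx_delt (j : Fin n) :
    nabla M N Γ (delx M N j) (delt M N) = comb M N 0 0 0 := by
  simp [nabla, comb, delt_t, delt_x, aV_delt, delx_t, Xact_zero, Xact_one, ← Pi.zero_def]

lemma nabla_delx_delx (i j : Fin n) :
    nabla M N Γ (delx M N j) (delx M N i) = comb M N 0 (fun k => Γ.L k i j) 0 := by
  simp [nabla, comb, delx_t, delx_x, aV_delx, Xact_zero, Xact_kron, sum_kron_mul]

lemma nabla_delx_party (i j : Fin n) :
    nabla M N Γ (delx M N j) (party M N i) = comb M N 0 0 (fun k => Γ.L k i j) := by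
  simp [nabla, comb, delx_t, delx_x, aV_delx, party_t, party_x, aV_party, Xact_zero, Xact_kron,
    sum_kron_mul, ← Pi.zero_def]

lemma nabla_party_delt (j : Fin n) :
    nabla M N Γ (party M N j) (delt M N) = comb M N 0 0 0 := by
  simp [nabla, comb, delt_t, delt_x, aV_delt, party_t, Xact_zero, Xact_one, ← Pi.zero_def]

lemma nabla_party_delx (i j : Fin n) :
    nabla M N Γ (party M N j) (delx M N i) = comb M N 0 (fun k => Γ.C k i j) 0 := by
  simp [nabla, comb, delx_t, delx_x, aV_delx, party_t, party_x, aV_party, Xact_zero, Xact_kron,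
    sum_kron_mul, ← Pi.zero_def]

lemma nabla_party_party (i j : Fin n) :
    nabla M N Γ (party M N j) (party M N i) = comb M N 0 0 (fun k => Γ.C k i j) := by
  simp [nabla, comb, party_t, party_x, aV_party, Xact_zero, Xact_kron, sum_kron_mul, ← Pi.zero_def]

/-! ### Lie brackets of the adapted frame -/

lemma bracket_self (X : VF n) : bracket X X = comb M N 0 0 0 := by
  simp [bracket, comb, ← Pi.zero_def]

lemma bracket_delx_delt (j : Fin n) :
    bracket (delx M N j) (delt M N) = comb M N 0 0 (fun r => -Rv1 M N r j) := by
  simp [bracket, comb, delt_t, delt_x, delt_y, delx_t, delx_x, delx_y, Xact_zero, Xact_one,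
    Xact_kron, Xact_neg, Xact_delt, Xact_delx, Rv1, neg_add_eq_sub, ← Pi.zero_def]

lemma bracket_delx_delx (i j : Fin n) :
    bracket (delx M N j) (delx M N i) = comb M N 0 0 (fun r => -Rvsp M N r i j) := by
  simp [bracket, comb, delx_t, delx_x, delx_y, Xact_zero,
    Xact_kron, Xact_neg, Xact_delx, Rvsp, neg_add_eq_sub, ← Pi.zero_def]

lemma bracket_party_delt (j : Fin n) :
    bracket (party M N j) (delt M N) = comb M N 0 0 (fun r => -py j (M r)) := by
  simp [bracket, comb, delt_t, delt_x, delt_y, party_t, party_x, party_y, Xact_zero, Xact_one,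
    Xact_kron, Xact_neg, Xact_party, ← Pi.zero_def]

lemma bracket_party_delx (i j : Fin n) :
    bracket (party M N j) (delx M N i) = comb M N 0 0 (fun r => -py j (N r i)) := by
  simp [bracket, comb, delx_t, delx_x, delx_y, party_t, party_x, party_y, Xact_zero,
    Xact_kron, Xact_neg, Xact_party, ← Pi.zero_def]

lemma bracket_party_party (i j : Fin n) :
    bracket (party M N j) (party M N i) = comb M N 0 0 0 := by
  simp [bracket, comb, party_t, party_x, party_y, Xact_zero, Xact_kron, ← Pi.zero_def]

/-! ### Torsion -/

lemma Tor_eq_comb {X Y : VF n} {aT bT eT : Fn n} {aH bH eH aW bW eW : Fin n → Fn n}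
    (hXY : nabla M N Γ X Y = comb M N aT aH aW) (hYX : nabla M N Γ Y X = comb M N bT bH bW)
    (hbr : bracket X Y = comb M N eT eH eW) :
    Tor M N Γ X Y = comb M N (aT - bT - eT) (aH - bH - eH) (aW - bW - eW) := by
  simp only [Tor, hXY, hYX, hbr, comb, VF.mk.injEq, true_and]
  refine ⟨rfl, funext fun k => ?_⟩
  simp only [Pi.sub_apply, sub_mul, sum_sub_distrib]
  ring

end AdaptedFrame

/-- the torsion of the covariant derivative induced by an `h`-normal
Γ-linear connection, on the adapted frame. -/
theorem torsion_of_h_normal_connection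
    (n : ℕ) (hn : 1 ≤ n)
    (h : ℝ → ℝ) (hh : ContDiff ℝ (⊤ : ℕ∞) h) (hhpos : ∀ t, 0 < h t)
    (M : Fin n → Fn n) (N : Fin n → Fin n → Fn n) (Γ : Conn n)
    (hκ : Γ.κ = chr h)
    (hMs : ∀ i, Smooth (M i)) (hNs : ∀ i j, Smooth (N i j))
    (hGs : ∀ k i, Smooth (Γ.G k i)) (hLs : ∀ k i j, Smooth (Γ.L k i j))
    (hCs : ∀ k i j, Smooth (Γ.C k i j)) :
    (Tor M N Γ (delt M N) (delt M N) = VF.zero)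
      ∧ (∀ j, Tor M N Γ (delx M N j) (delt M N)
          = comb M N 0 (fun r => T1 Γ r j) (fun r => Rv1 M N r j))
      ∧ (∀ i j, Tor M N Γ (delx M N j) (delx M N i)
          = comb M N 0 (fun r => Tsp Γ r i j) (fun r => Rvsp M N r i j))
      ∧ (∀ j, Tor M N Γ (party M N j) (delt M N)
          = comb M N 0 0 (fun r => Pv1 M Γ r j))
      ∧ (∀ i j, Tor M N Γ (party M N j) (delx M N i)
          = comb M N 0 (fun r => Γ.C r i j) (fun r => Pvsp N Γ r i j))
      ∧ (∀ i j, Tor M N Γ (party M N j) (party M N i)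
          = comb M N 0 0 (fun r => Ssp Γ r i j)) := by
  refine ⟨?_, fun j => ?_, fun i j => ?_, fun j => ?_, fun i j => ?_, fun i j => ?_⟩
  · rw [Tor_eq_comb M N Γ (nabla_delt_delt M N Γ) (nabla_delt_delt M N Γ)
      (bracket_self M N _)]
    simp [comb, VF.zero, ← Pi.zero_def]
  · rw [Tor_eq_comb M N Γ (nabla_delx_delt M N Γ j) (nabla_delt_delx M N Γ j)
      (bracket_delx_delt M N j)]
    congr 1 <;> funext r <;> simp [T1]
  · rw [Tor_eq_comb M N Γ (nabla_delx_delx M N Γ i j) (nabla_delx_delx M N Γ j i)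
      (bracket_delx_delx M N i j)]
    congr 1 <;> funext r <;> simp [Tsp]
  · rw [Tor_eq_comb M N Γ (nabla_party_delt M N Γ j) (nabla_delt_party M N Γ j)
      (bracket_party_delt M N j)]
    congr 1 <;> funext r <;> simp [Pv1]
    ring
  · rw [Tor_eq_comb M N Γ (nabla_party_delx M N Γ i j) (nabla_delx_party M N Γ j i)
      (bracket_party_delx M N i j)]
    congr 1 <;> funext r <;> simp [Pvsp]
    ring
  · rw [Tor_eq_comb M N Γ (nabla_party_party M N Γ i j) (nabla_party_party M N Γ j i)
      (bracket_party_party M N i j)]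
    congr 1 <;> funext r <;> simp [Ssp]

end Jet
end
end

section
/- For every h-normal Γ-linear connection of Cartan type and every smooth function X1 of (t, x, y), typed as a d-tensor with a single upper temporal index, the following local Ricci identities hold for all indices j, k: (X1_/1)_|k − (X1_|k)_/1 = −X1_|r T^r_1k − X1|_(r) Rv^r_1k; (X1_|j)_|k − (X1_|k)_|j = −X1|_(r) Rv^r_jk; (X1_/1)|_(k) − (X1|_(k))_/1 = −X1|_(r) Pv^r_1k; (X1_|j)|_(k) − (X1|_(k))_|j = −X1_|r C^r_jk − X1|_(r) Pv^r_jk; (X1|_(j))|_(k) − (X1|_(k))|_(j) = 0. -/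
open Finset

noncomputable section

namespace Jet

variable {n : ℕ}

/-- A family with one valued index, viewed as a d-tensor. -/
def famT (X : Fin n → Fn n) : Tensor n 1 := fun a => X (a 0)

def T1T (Γ : Conn n) : Tensor n 2 := fun a => T1 Γ (a 0) (a 1)
def Rv1T (M : Fin n → Fn n) (N : Fin n → Fin n → Fn n) : Tensor n 2 :=
  fun a => Rv1 M N (a 0) (a 1)
def RvspT (M : Fin n → Fn n) (N : Fin n → Fin n → Fn n) : Tensor n 3 :=
  fun a => Rvsp M N (a 0) (a 1) (a 2)
def Pv1T (M : Fin n → Fn n) (Γ : Conn n) : Tensor n 2 := fun a => Pv1 M Γ (a 0) (a 1)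
def PvspT (N : Fin n → Fin n → Fn n) (Γ : Conn n) : Tensor n 3 :=
  fun a => Pvsp N Γ (a 0) (a 1) (a 2)
def Rc1T (M : Fin n → Fn n) (N : Fin n → Fin n → Fn n) (Γ : Conn n) : Tensor n 3 :=
  fun a => Rc1 M N Γ (a 0) (a 1) (a 2)
def RcT (M : Fin n → Fn n) (N : Fin n → Fin n → Fn n) (Γ : Conn n) : Tensor n 4 :=
  fun a => Rc M N Γ (a 0) (a 1) (a 2) (a 3)
def Pc1T (M : Fin n → Fn n) (N : Fin n → Fin n → Fn n) (Γ : Conn n) : Tensor n 3 :=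
  fun a => Pc1 M N Γ (a 0) (a 1) (a 2)
def PcT (M : Fin n → Fn n) (N : Fin n → Fin n → Fn n) (Γ : Conn n) : Tensor n 4 :=
  fun a => Pc M N Γ (a 0) (a 1) (a 2) (a 3)
def ScT (Γ : Conn n) : Tensor n 4 := fun a => Sc Γ (a 0) (a 1) (a 2) (a 3)

/-- valued-index signatures (temporal indices are tracked by the weight `p` only) -/
def sig0 : Fin 0 → IdxType := ![]
def siglS : Fin 1 → IdxType := ![IdxType.lS]
def siglV : Fin 1 → IdxType := ![IdxType.lV]
def sigU : Fin 1 → IdxType := ![IdxType.uS]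
def sigV : Fin 1 → IdxType := ![IdxType.uV]
def sigUlS : Fin 2 → IdxType := ![IdxType.uS, IdxType.lS]
def sigUlV : Fin 2 → IdxType := ![IdxType.uS, IdxType.lV]
def sigVlS : Fin 2 → IdxType := ![IdxType.uV, IdxType.lS]
def sigVlV : Fin 2 → IdxType := ![IdxType.uV, IdxType.lV]
def sigRvsp : Fin 3 → IdxType := ![IdxType.uV, IdxType.lS, IdxType.lS]
def sigPvsp : Fin 3 → IdxType := ![IdxType.uV, IdxType.lS, IdxType.lV]
def sigRc1 : Fin 3 → IdxType := ![IdxType.uS, IdxType.lS, IdxType.lS]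
def sigRc : Fin 4 → IdxType := ![IdxType.uS, IdxType.lS, IdxType.lS, IdxType.lS]
def sigPc1 : Fin 3 → IdxType := ![IdxType.uS, IdxType.lS, IdxType.lV]
def sigPc : Fin 4 → IdxType := ![IdxType.uS, IdxType.lS, IdxType.lS, IdxType.lV]
def sigSc : Fin 4 → IdxType := ![IdxType.uS, IdxType.lS, IdxType.lV, IdxType.lV]

end Jet

namespace Jet

section Calculus

variable {n : ℕ}

/-- A function on the jet space, as a function of a single variable. -/
def uncurried (F : Fn n) : ℝ × (Fin n → ℝ) × (Fin n → ℝ) → ℝ := fun p => F p.1 p.2.1 p.2.2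

/-- The derivative of a function on the jet space along a constant vector. -/
def dirD (v : ℝ × (Fin n → ℝ) × (Fin n → ℝ)) (F : Fn n) : Fn n :=
  fun t x y => fderiv ℝ (uncurried F) (t, x, y) v

/-- The derivation `∂ᵥ − Aʳ ∂/∂yʳ`, for a constant vector `v`. -/
def lift (A : Fin n → Fn n) (v : ℝ × (Fin n → ℝ) × (Fin n → ℝ)) (F : Fn n) : Fn n :=
  dirD v F - ∑ r, A r * dirD (0, 0, Pi.single r 1) F

namespace Smooth

variable {F H : Fn n}

theorem differentiableAt (hF : Smooth F) (p : ℝ × (Fin n → ℝ) × (Fin n → ℝ)) :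
    DifferentiableAt ℝ (uncurried F) p :=
  (ContDiff.differentiable hF (by simp)) p

theorem mul (hF : Smooth F) (hH : Smooth H) : Smooth (F * H) := ContDiff.mul hF hH

theorem add (hF : Smooth F) (hH : Smooth H) : Smooth (F + H) := ContDiff.add hF hH

theorem sub (hF : Smooth F) (hH : Smooth H) : Smooth (F - H) := ContDiff.sub hF hH

theorem sum {ι : Type*} {s : Finset ι} {f : ι → Fn n} (hf : ∀ i, Smooth (f i)) :
    Smooth (∑ i ∈ s, f i) := by
  unfold Smooth
  simp only [Finset.sum_apply]
  exact ContDiff.sum fun i _ => hf i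

theorem dirD (hF : Smooth F) (v : ℝ × (Fin n → ℝ) × (Fin n → ℝ)) : Smooth (dirD v F) :=
  (ContDiff.fderiv_right (m := (⊤ : ℕ∞)) hF (by simp)).clm_apply contDiff_const

theorem lift (hF : Smooth F) {A : Fin n → Fn n} (hA : ∀ r, Smooth (A r))
    (v : ℝ × (Fin n → ℝ) × (Fin n → ℝ)) : Smooth (lift A v F) :=
  (hF.dirD v).sub (sum fun r => (hA r).mul (hF.dirD _))

end Smooth

theorem smooth_zero : Smooth (0 : Fn n) := contDiff_const

theorem pt_eq_dirD {F : Fn n} (hF : Smooth F) : pt F = dirD (1, 0, 0) F := by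
  funext t x y
  have h := (hF.differentiableAt (t, x, y)).hasFDerivAt
  exact (h.comp_hasDerivAt t ((hasDerivAt_id t).prodMk
    ((hasDerivAt_const t x).prodMk (hasDerivAt_const t y)))).deriv

theorem px_eq_dirD {F : Fn n} (hF : Smooth F) (i : Fin n) :
    px i F = dirD (0, Pi.single i 1, 0) F := by
  funext t x y
  have h : HasFDerivAt (uncurried F) (fderiv ℝ (uncurried F) (t, x, y))
      (t, Function.update x i (x i), y) := by
    rw [Function.update_eq_self]
    exact (hF.differentiableAt (t, x, y)).hasFDerivAt
  exact (h.comp_hasDerivAt (x i) ((hasDerivAt_const (x i) t).prodMk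
    ((hasDerivAt_update x i (x i)).prodMk (hasDerivAt_const (x i) y)))).deriv

theorem py_eq_dirD {F : Fn n} (hF : Smooth F) (i : Fin n) :
    py i F = dirD (0, 0, Pi.single i 1) F := by
  funext t x y
  have h : HasFDerivAt (uncurried F) (fderiv ℝ (uncurried F) (t, x, y))
      (t, x, Function.update y i (y i)) := by
    rw [Function.update_eq_self]
    exact (hF.differentiableAt (t, x, y)).hasFDerivAt
  exact (h.comp_hasDerivAt (y i) ((hasDerivAt_const (y i) t).prodMk
    ((hasDerivAt_const (y i) x).prodMk (hasDerivAt_update y i (y i))))).deriv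

section Derivation

variable {F H : Fn n} (v w : ℝ × (Fin n → ℝ) × (Fin n → ℝ))

theorem dirD_mul (hF : Smooth F) (hH : Smooth H) :
    dirD v (F * H) = F * dirD v H + dirD v F * H := by
  funext t x y
  have h := ((hF.differentiableAt (t, x, y)).hasFDerivAt.mul
    (hH.differentiableAt (t, x, y)).hasFDerivAt).fderiv
  refine (congrArg (fun L => L v) h).trans ?_
  simp [dirD, uncurried, mul_comm]

theorem dirD_sub (hF : Smooth F) (hH : Smooth H) :
    dirD v (F - H) = dirD v F - dirD v H := by
  funext t x y
  exact congrArg (fun L => L v) ((hF.differentiableAt (t, x, y)).hasFDerivAt.sub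
    (hH.differentiableAt (t, x, y)).hasFDerivAt).fderiv

theorem dirD_add (hF : Smooth F) (hH : Smooth H) :
    dirD v (F + H) = dirD v F + dirD v H := by
  funext t x y
  exact congrArg (fun L => L v) ((hF.differentiableAt (t, x, y)).hasFDerivAt.add
    (hH.differentiableAt (t, x, y)).hasFDerivAt).fderiv

theorem dirD_sum {ι : Type*} {s : Finset ι} {f : ι → Fn n} (hf : ∀ i, Smooth (f i)) :
    dirD v (∑ i ∈ s, f i) = ∑ i ∈ s, dirD v (f i) := by
  funext t x y
  have h := (HasFDerivAt.fun_sum (u := s)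
    fun i _ => ((hf i).differentiableAt (t, x, y)).hasFDerivAt).fderiv
  have e : uncurried (∑ i ∈ s, f i) = fun p => ∑ i ∈ s, uncurried (f i) p := by
    funext p
    simp [uncurried]
  simp [dirD, e, h]

theorem dirD_comm (hF : Smooth F) : dirD v (dirD w F) = dirD w (dirD v F) := by
  have key : ∀ (a b : ℝ × (Fin n → ℝ) × (Fin n → ℝ)) t x y, dirD a (dirD b F) t x y =
      fderiv ℝ (fderiv ℝ (uncurried F)) (t, x, y) a b := by
    intro a b t x y
    have h : DifferentiableAt ℝ (fderiv ℝ (uncurried F)) (t, x, y) :=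
      (ContDiff.fderiv_right (m := (⊤ : ℕ∞)) hF (by simp)).differentiable (by simp) _
    have h' := (h.hasFDerivAt.clm_apply (hasFDerivAt_const b _)).fderiv
    refine (congrArg (fun L => L a) h').trans ?_
    simp
  funext t x y
  rw [key, key]
  refine ContDiffAt.isSymmSndFDerivAt (n := (⊤ : ℕ∞)) (ContDiff.contDiffAt hF) ?_ v w
  rw [minSmoothness_of_isRCLikeNormedField]
  exact WithTop.coe_le_coe.mpr (le_top : (2 : ℕ∞) ≤ ⊤)

theorem lift_mul (A : Fin n → Fn n) (hF : Smooth F) (hH : Smooth H) :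
    lift A v (F * H) = F * lift A v H + lift A v F * H := by
  simp only [lift, dirD_mul _ hF hH, mul_sub, sub_mul, mul_add, Finset.mul_sum, Finset.sum_mul,
    Finset.sum_add_distrib]
  simp only [mul_assoc, mul_left_comm]
  abel

theorem lift_add (A : Fin n → Fn n) (hF : Smooth F) (hH : Smooth H) :
    lift A v (F + H) = lift A v F + lift A v H := by
  simp only [lift, dirD_add _ hF hH, mul_add, Finset.sum_add_distrib]
  abel

theorem lift_sub (A : Fin n → Fn n) (hF : Smooth F) (hH : Smooth H) :
    lift A v (F - H) = lift A v F - lift A v H := by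
  simp only [lift, dirD_sub _ hF hH, mul_sub, Finset.sum_sub_distrib]
  abel

theorem lift_sum (A : Fin n → Fn n) {ι : Type*} {s : Finset ι} {f : ι → Fn n}
    (hf : ∀ i, Smooth (f i)) : lift A v (∑ i ∈ s, f i) = ∑ i ∈ s, lift A v (f i) := by
  simp only [lift, dirD_sum _ hf, Finset.sum_sub_distrib, Finset.mul_sum]
  rw [Finset.sum_comm]

/-- The derivations `lift A v` commute up to a vertical derivation. -/
theorem lift_comm {A B : Fin n → Fn n} (hA : ∀ r, Smooth (A r)) (hB : ∀ r, Smooth (B r))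
    (hF : Smooth F) :
    lift A v (lift B w F) - lift B w (lift A v F)
      = -∑ r, dirD (0, 0, Pi.single r 1) F * (lift A v (B r) - lift B w (A r)) := by
  have expand : ∀ {A B : Fin n → Fn n} (v w : ℝ × (Fin n → ℝ) × (Fin n → ℝ)),
      (∀ r, Smooth (B r)) → lift A v (lift B w F) =
        dirD v (dirD w F) - ∑ s, A s * dirD (0, 0, Pi.single s 1) (dirD w F)
        - (∑ r, B r * dirD (0, 0, Pi.single r 1) (dirD v F)
          - ∑ r, ∑ s, B r * (A s * dirD (0, 0, Pi.single s 1) (dirD (0, 0, Pi.single r 1) F))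
          + ∑ r, dirD (0, 0, Pi.single r 1) F * lift A v (B r)) := by
    intro A B v w hB
    have hy : ∀ r : Fin n, Smooth (dirD (0, 0, Pi.single r 1) F) := fun r => hF.dirD _
    conv_lhs => rw [lift.eq_def B w F]
    rw [lift_sub _ _ (hF.dirD w) (Smooth.sum fun r => (hB r).mul (hy r)),
      lift_sum _ _ fun r => (hB r).mul (hy r)]
    simp only [lift_mul _ _ (hB _) (hy _), Finset.sum_add_distrib]
    congr 1
    congr 1
    · simp only [lift, mul_sub, Finset.sum_sub_distrib, Finset.mul_sum, dirD_comm v _ hF]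
    · simp only [mul_comm]
  rw [expand v w hB, expand w v hA, dirD_comm w v hF]
  have hs : ∑ r, ∑ s, A r * (B s * dirD (0, 0, Pi.single s 1) (dirD (0, 0, Pi.single r 1) F)) =
      ∑ r, ∑ s, B r * (A s * dirD (0, 0, Pi.single s 1) (dirD (0, 0, Pi.single r 1) F)) := by
    rw [Finset.sum_comm]
    refine Finset.sum_congr rfl fun r _ => Finset.sum_congr rfl fun s _ => ?_
    rw [dirD_comm _ _ hF, mul_left_comm]
  rw [hs]
  simp only [mul_sub, Finset.sum_sub_distrib]
  abel

end Derivation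

theorem dt_eq_lift (M : Fin n → Fn n) {F : Fn n} (hF : Smooth F) :
    dt M F = lift M (1, 0, 0) F := by
  simp only [dt, lift, pt_eq_dirD hF, py_eq_dirD hF]

theorem dx_eq_lift (N : Fin n → Fin n → Fn n) (k : Fin n) {F : Fn n} (hF : Smooth F) :
    dx N k F = lift (fun r => N r k) (0, Pi.single k 1, 0) F := by
  simp only [dx, lift, px_eq_dirD hF, py_eq_dirD hF]

theorem py_eq_lift (k : Fin n) {F : Fn n} (hF : Smooth F) :
    py k F = lift (fun _ => 0) (0, 0, Pi.single k 1) F := by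
  simp [lift, py_eq_dirD hF]

theorem lift_zero (A : Fin n → Fn n) (v : ℝ × (Fin n → ℝ) × (Fin n → ℝ)) :
    lift A v (0 : Fn n) = 0 := by
  have h := lift_sub v A (smooth_zero (n := n)) smooth_zero
  simpa using h

theorem smooth_chr {h : ℝ → ℝ} (hh : ContDiff ℝ (⊤ : ℕ∞) h) (hpos : ∀ t, 0 < h t) :
    Smooth (chr h : Fn n) := by
  have hd : ContDiff ℝ (⊤ : ℕ∞) (deriv h) := by
    have := hh.iterate_deriv 1
    simpa using this
  exact (hd.div (contDiff_const.mul hh) fun t => by have := hpos t; positivity).comp contDiff_fst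

theorem py_chr (h : ℝ → ℝ) (k : Fin n) : py k (chr h) = 0 := by
  funext t x y
  simp [py, chr]

theorem dx_chr (N : Fin n → Fin n → Fn n) (h : ℝ → ℝ) (k : Fin n) : dx N k (chr h) = 0 := by
  have : px k (chr h : Fn n) = 0 := by
    funext t x y
    simp [px, chr]
  simp [dx, this, py_chr]

section Commutators

variable {M : Fin n → Fn n} {N : Fin n → Fin n → Fn n} {F : Fn n}

theorem dx_dt_comm (hM : ∀ i, Smooth (M i)) (hN : ∀ i j, Smooth (N i j)) (hF : Smooth F)
    (k : Fin n) : dx N k (dt M F) - dt M (dx N k F) = -∑ r, py r F * Rv1 M N r k := by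
  simp only [Rv1, dt_eq_lift _ hF, dx_eq_lift _ _ hF, py_eq_dirD hF, dx_eq_lift _ _ (hM _),
    dt_eq_lift _ (hN _ _), dx_eq_lift _ _ (hF.lift hM _),
    dt_eq_lift _ (hF.lift (fun r => hN r k) _)]
  rw [lift_comm _ _ (fun r => hN r k) hM hF]

theorem dx_dx_comm (M : Fin n → Fn n) (hN : ∀ i j, Smooth (N i j)) (hF : Smooth F)
    (j k : Fin n) : dx N k (dx N j F) - dx N j (dx N k F) = -∑ r, py r F * Rvsp M N r j k := by
  simp only [Rvsp, dx_eq_lift _ _ hF, py_eq_dirD hF, dx_eq_lift _ _ (hN _ _),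
    dx_eq_lift _ _ (hF.lift (fun r => hN r j) _), dx_eq_lift _ _ (hF.lift (fun r => hN r k) _)]
  rw [lift_comm _ _ (fun r => hN r k) (fun r => hN r j) hF]

theorem py_dt_comm (hM : ∀ i, Smooth (M i)) (hF : Smooth F) (k : Fin n) :
    py k (dt M F) - dt M (py k F) = -∑ r, py r F * py k (M r) := by
  rw [dt_eq_lift _ hF, py_eq_lift k hF, py_eq_lift k (hF.lift hM _),
    dt_eq_lift _ (hF.lift (fun _ => smooth_zero) _), lift_comm _ _ (fun _ => smooth_zero) hM hF]
  simp only [lift_zero, sub_zero, py_eq_lift k (hM _), py_eq_dirD hF]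

theorem py_dx_comm (hN : ∀ i j, Smooth (N i j)) (hF : Smooth F) (j k : Fin n) :
    py k (dx N j F) - dx N j (py k F) = -∑ r, py r F * py k (N r j) := by
  rw [dx_eq_lift _ _ hF, py_eq_lift k hF, py_eq_lift k (hF.lift (fun r => hN r j) _),
    dx_eq_lift _ _ (hF.lift (fun _ => smooth_zero) _),
    lift_comm _ _ (fun _ => smooth_zero) (fun r => hN r j) hF]
  simp only [lift_zero, sub_zero, py_eq_lift k (hN _ _), py_eq_dirD hF]

theorem py_py_comm (hF : Smooth F) (j k : Fin n) : py k (py j F) = py j (py k F) := by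
  rw [py_eq_dirD hF, py_eq_dirD hF, py_eq_dirD (hF.dirD _), py_eq_dirD (hF.dirD _),
    dirD_comm _ _ hF]

theorem dx_dt_add_chr_mul {h : ℝ → ℝ} (hh : Smooth (chr h : Fn n)) (hM : ∀ i, Smooth (M i))
    (hF : Smooth F) (k : Fin n) :
    dx N k (dt M F + chr h * F) = dx N k (dt M F) + chr h * dx N k F := by
  have hκ := dx_chr N h k
  rw [dx_eq_lift _ _ hh] at hκ
  rw [dt_eq_lift _ hF, dx_eq_lift _ _ ((hF.lift hM _).add (hh.mul hF)),
    lift_add _ _ (hF.lift hM _) (hh.mul hF), lift_mul _ _ hh hF, hκ, dx_eq_lift _ _ hF,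
    dx_eq_lift _ _ (hF.lift hM _), zero_mul, add_zero]

theorem py_dt_add_chr_mul {h : ℝ → ℝ} (hh : Smooth (chr h : Fn n)) (hM : ∀ i, Smooth (M i))
    (hF : Smooth F) (k : Fin n) :
    py k (dt M F + chr h * F) = py k (dt M F) + chr h * py k F := by
  have hκ := py_chr h k
  rw [py_eq_dirD hh] at hκ
  rw [dt_eq_lift _ hF, py_eq_dirD ((hF.lift hM _).add (hh.mul hF)),
    dirD_add _ (hF.lift hM _) (hh.mul hF), dirD_mul _ hh hF, hκ, py_eq_dirD hF,
    py_eq_dirD (hF.lift hM _), zero_mul, add_zero]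

end Commutators

theorem sum_mul_kron (f : Fin n → Fn n) (k : Fin n) : ∑ r, f r * kron r k = f k := by
  simp [kron]

end Calculus

/-- local Ricci identities for a d-tensor `X¹` with a single upper
temporal index, for an `h`-normal Γ-linear connection of Cartan type. -/
theorem ricci_identities_upper_temporal
    (n : ℕ) (hn : 1 ≤ n)
    (h : ℝ → ℝ) (hh : ContDiff ℝ (⊤ : ℕ∞) h) (hhpos : ∀ t, 0 < h t)
    (M : Fin n → Fn n) (N : Fin n → Fin n → Fn n) (Γ : Conn n)
    (hκ : Γ.κ = chr h)
    (hMs : ∀ i, Smooth (M i)) (hNs : ∀ i j, Smooth (N i j))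
    (hGs : ∀ k i, Smooth (Γ.G k i)) (hLs : ∀ k i j, Smooth (Γ.L k i j))
    (hCs : ∀ k i j, Smooth (Γ.C k i j))
    (hLsym : ∀ k i j, Γ.L k i j = Γ.L k j i) (hCsym : ∀ k i j, Γ.C k i j = Γ.C k j i)
    (X1 : Fn n) (hX1 : Smooth X1) :
    (∀ k, covX N Γ sig0 k (covT M Γ 1 sig0 (fun _ => X1)) ![]
        - covT M Γ 1 siglS (fun a => covX N Γ sig0 (a 0) (fun _ => X1) ![]) ![k]
      = -(∑ r, (covX N Γ sig0 r (fun _ => X1) ![]) * T1 Γ r k)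
        - (∑ r, (covY Γ sig0 r (fun _ => X1) ![]) * Rv1 M N r k))
    ∧ (∀ j k, covX N Γ siglS k (fun a => covX N Γ sig0 (a 0) (fun _ => X1) ![]) ![j]
        - covX N Γ siglS j (fun a => covX N Γ sig0 (a 0) (fun _ => X1) ![]) ![k]
      = -(∑ r, (covY Γ sig0 r (fun _ => X1) ![]) * Rvsp M N r j k))
    ∧ (∀ k, covY Γ sig0 k (covT M Γ 1 sig0 (fun _ => X1)) ![]
        - covT M Γ 1 siglV (fun a => covY Γ sig0 (a 0) (fun _ => X1) ![]) ![k]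
      = -(∑ r, (covY Γ sig0 r (fun _ => X1) ![]) * Pv1 M Γ r k))
    ∧ (∀ j k, covY Γ siglS k (fun a => covX N Γ sig0 (a 0) (fun _ => X1) ![]) ![j]
        - covX N Γ siglV j (fun a => covY Γ sig0 (a 0) (fun _ => X1) ![]) ![k]
      = -(∑ r, (covX N Γ sig0 r (fun _ => X1) ![]) * Γ.C r j k)
        - (∑ r, (covY Γ sig0 r (fun _ => X1) ![]) * Pvsp N Γ r j k))
    ∧ (∀ j k, covY Γ siglV k (fun a => covY Γ sig0 (a 0) (fun _ => X1) ![]) ![j]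
        - covY Γ siglV j (fun a => covY Γ sig0 (a 0) (fun _ => X1) ![]) ![k]
      = 0) := by
  have hκs : Smooth (chr h : Fn n) := smooth_chr hh hhpos
  refine ⟨fun k => ?_, fun j k => ?_, fun k => ?_, fun j k => ?_, fun j k => ?_⟩
  · simp only [covX, covT, covY, siglS, univ_eq_empty, sum_empty, add_zero, univ_unique,
      sum_singleton, Matrix.cons_val_fin_one, Function.update_self, Fin.default_eq_zero,
      one_smul, T1, hκ, dx_dt_add_chr_mul hκs hMs hX1, mul_neg, sum_neg_distrib, neg_neg]
    rw [← sub_eq_zero, ← sub_eq_zero.mpr (dx_dt_comm hMs hNs hX1 k)]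
    abel
  · simp only [covX, covY, siglS, univ_eq_empty, sum_empty, add_zero, univ_unique,
      sum_singleton, Matrix.cons_val_fin_one, Function.update_self, Fin.default_eq_zero,
      hLsym _ k j]
    rw [← dx_dx_comm M hNs hX1 j k]
    abel
  · simp only [covT, covY, siglV, univ_eq_empty, sum_empty, add_zero, univ_unique,
      sum_singleton, Matrix.cons_val_fin_one, Function.update_self, Fin.default_eq_zero,
      one_smul, Pv1, hκ, py_dt_add_chr_mul hκs hMs hX1, mul_add, mul_sub, sum_add_distrib,
      sum_sub_distrib, ← mul_assoc, ← sum_mul, sum_mul_kron]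
    rw [← sub_eq_zero, ← sub_eq_zero.mpr (py_dt_comm hMs hX1 k), mul_comm (chr h)]
    abel
  · simp only [covX, covY, siglS, siglV, univ_eq_empty, sum_empty, add_zero, univ_unique,
      sum_singleton, Matrix.cons_val_fin_one, Function.update_self, Fin.default_eq_zero,
      Pvsp, mul_sub, sum_sub_distrib]
    rw [← sub_eq_zero, ← sub_eq_zero.mpr (py_dx_comm hNs hX1 j k)]
    abel
  · simp only [covY, siglV, univ_eq_empty, sum_empty, add_zero, univ_unique,
      sum_singleton, Matrix.cons_val_fin_one, Function.update_self, Fin.default_eq_zero,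
      hCsym _ k j, py_py_comm hX1 j k, sub_self]

end Jet
end
end
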